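/- arXiv:1808.04047 — 3 statements merged into one kernel-verified Lean document; each statement's English description precedes it below -/
import Mathlib

section
/- Let G be an embedded graph and A ⊆ E(G). If the partial dual G^A is checkerboard colourable, then G − A and G* − A^c are both checkerboard colourable (and hence both Eulerian), where A^c = E(G) \ A. -/
/-!
A combinatorial model of ribbon graphs (embedded graphs) via flag systems
(graph-encoded maps): a set of flags together with three involutions
`t0` (change vertex), `t1` (change edge), `t2` (change face), where `t0` and
`t2` commute.  Vertices are the orbits of `⟨t1,t2⟩`, edges the orbits of
`⟨t0,t2⟩`, and faces (= boundary components of the ribbon graph) the orbits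
of `⟨t0,t1⟩`.
-/

structure RibbonGraph where
  flags : Type
  t0 : flags → flags
  t1 : flags → flags
  t2 : flags → flags

namespace RibbonGraph

open Classical

/-- The axioms making a flag system a genuine ribbon graph (gem):
finiteness, the three maps are fixed-point-free involutions, and
`t0`, `t2` commute with `t0 ∘ t2` fixed-point-free. -/
def IsRibbon (G : RibbonGraph) : Prop :=
  Finite G.flags ∧
  Function.Involutive G.t0 ∧ Function.Involutive G.t1 ∧ Function.Involutive G.t2 ∧
  (∀ x, G.t0 (G.t2 x) = G.t2 (G.t0 x)) ∧
  (∀ x, G.t0 x ≠ x) ∧ (∀ x, G.t1 x ≠ x) ∧ (∀ x, G.t2 x ≠ x) ∧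
  (∀ x, G.t0 (G.t2 x) ≠ x)

/-- A set of flags represents a subset `A ⊆ E(G)` of the edge set iff it is a
union of edge orbits, i.e. closed under `t0` and `t2`. -/
def IsEdgeSet (G : RibbonGraph) (A : Set G.flags) : Prop :=
  ∀ x ∈ A, G.t0 x ∈ A ∧ G.t2 x ∈ A

/-- The edge of `G` containing the flag `x`, as its `⟨t0,t2⟩`-orbit. -/
def edgeOf (G : RibbonGraph) (x : G.flags) : Set G.flags :=
  {x, G.t0 x, G.t2 x, G.t0 (G.t2 x)}

/-- Partial dual `G^{δ(A)}`: interchange the roles of `t0` and `t2`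
on the flags of the edges in `A`. -/
noncomputable def pdual (G : RibbonGraph) (A : Set G.flags) : RibbonGraph where
  flags := G.flags
  t0 := fun x => if x ∈ A then G.t2 x else G.t0 x
  t1 := G.t1
  t2 := fun x => if x ∈ A then G.t0 x else G.t2 x

/-- Partial Petrial `G^{τ(A)}` (half-twist on each edge of `A`):
replace `t0` by `t0 ∘ t2` on the flags of the edges in `A`. -/
noncomputable def ppetrial (G : RibbonGraph) (A : Set G.flags) : RibbonGraph where
  flags := G.flags
  t0 := fun x => if x ∈ A then G.t0 (G.t2 x) else G.t0 x
  t1 := G.t1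
  t2 := G.t2

/-- Geometric dual `G*`. -/
noncomputable def gdual (G : RibbonGraph) : RibbonGraph := G.pdual Set.univ

/-- Petrial `G^×`. -/
noncomputable def petrial (G : RibbonGraph) : RibbonGraph := G.ppetrial Set.univ

/-- Auxiliary function for edge deletion: starting from a flag, skip (around
the vertex) over the flags of deleted edges until a surviving flag is found. -/
noncomputable def delSkip (G : RibbonGraph) (A : Set G.flags) : ℕ → G.flags → G.flags
  | 0, y => y
  | n + 1, y => if y ∈ A then G.delSkip A n (G.t1 (G.t2 y)) else y

/-- Deletion `G − A` of the set of edges `A`: discard the flags of the edges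
in `A`; `t0` and `t2` restrict, and the corner involution `t1` skips over the
deleted edges around each vertex. -/
noncomputable def del (G : RibbonGraph) (A : Set G.flags) : RibbonGraph where
  flags := {x : G.flags // x ∉ A}
  t0 := fun x => if h : G.t0 x.1 ∉ A then ⟨G.t0 x.1, h⟩ else x
  t1 := fun x =>
    if h : G.delSkip A (Nat.card G.flags + 1) (G.t1 x.1) ∉ A then
      ⟨G.delSkip A (Nat.card G.flags + 1) (G.t1 x.1), h⟩
    else x
  t2 := fun x => if h : G.t2 x.1 ∉ A then ⟨G.t2 x.1, h⟩ else x

/-- Contraction `G/A := G^A − A`. -/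
noncomputable def contract (G : RibbonGraph) (A : Set G.flags) : RibbonGraph :=
  (G.pdual A).del A

/-- `G − B/C`: delete the edges of `B` and contract the edges of `C`
(for disjoint `B`, `C`). -/
noncomputable def delContract (G : RibbonGraph) (B C : Set G.flags) : RibbonGraph :=
  (G.pdual C).del (B ∪ C)

/-- Isomorphism (equality as embedded graphs): a flag bijection commuting
with the three involutions. -/
def Iso (G H : RibbonGraph) : Prop :=
  ∃ e : G.flags ≃ H.flags,
    (∀ x, e (G.t0 x) = H.t0 (e x)) ∧
    (∀ x, e (G.t1 x) = H.t1 (e x)) ∧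
    (∀ x, e (G.t2 x) = H.t2 (e x))

/-- Orientability of the ribbon graph as a surface with boundary:
the flag graph is bipartite. -/
def Orientable (G : RibbonGraph) : Prop :=
  ∃ c : G.flags → Bool, ∀ x,
    c (G.t0 x) = !c x ∧ c (G.t1 x) = !c x ∧ c (G.t2 x) = !c x

/-- Checkerboard colourability: a red/blue colouring of the flags, constant
on faces (`⟨t0,t1⟩`-orbits), such that the two faces on the two sides of any
edge (related by `t2`) receive different colours. -/
def CheckerboardColourable (G : RibbonGraph) : Prop :=
  ∃ c : G.flags → Bool, ∀ x,
    c (G.t0 x) = c x ∧ c (G.t1 x) = c x ∧ c (G.t2 x) = !c x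

/-- Bipartiteness (no odd cycles): a proper two-colouring of the flags,
constant on vertices (`⟨t1,t2⟩`-orbits), with the two endpoints of any edge
(related by `t0`) coloured differently. -/
def Bipartite (G : RibbonGraph) : Prop :=
  ∃ c : G.flags → Bool, ∀ x,
    c (G.t0 x) = !c x ∧ c (G.t1 x) = c x ∧ c (G.t2 x) = c x

/-- Two flags lie at the same vertex iff they are in the same
`⟨t1,t2⟩`-orbit. -/
def sameVertex (G : RibbonGraph) : G.flags → G.flags → Prop :=
  Relation.ReflTransGen (fun a b => G.t1 a = b ∨ G.t2 a = b)

/-- The degree of the vertex containing the flag `x`: half the number of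
flags in its `⟨t1,t2⟩`-orbit. -/
noncomputable def degree (G : RibbonGraph) (x : G.flags) : ℕ :=
  ({y | G.sameVertex x y}).ncard / 2

/-- Eulerian: every vertex has even degree. -/
def Eulerian (G : RibbonGraph) : Prop := ∀ x, Even (G.degree x)

/-- An all-crossing direction of the medial graph `G_m`, encoded on the flags
of `G`: edges of `G_m` correspond to `t1`-pairs of flags (corners of `G`) and
`o x` records whether the corner at `x` is directed out of the edge of `x`.
The first condition says each medial edge gets one consistent direction; the
second says that around each medial vertex (edge of `G`, whose four corners
occur in cyclic order `x, t0 x, t2 (t0 x), t2 x`) the directions read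
head, head, tail, tail. -/
def IsAllCrossing (G : RibbonGraph) (o : G.flags → Bool) : Prop :=
  (∀ x, o (G.t1 x) = !o x) ∧ (∀ x, o (G.t0 (G.t2 x)) = !o x)

/-- The set of `d`-edges of `G` arising from an all-crossing direction `o`
of the medial graph. -/
def dEdges (G : RibbonGraph) (o : G.flags → Bool) : Set G.flags :=
  {x | o (G.t0 x) = o x}

/-- Generators of the group `⟨δ, τ | δ², τ², (δτ)³⟩` of twisted duality. -/
inductive GenOp | d | t

/-- Apply a word in `δ, τ` partially, with respect to a fixed set of edges. -/
noncomputable def applyWord : List GenOp → (G : RibbonGraph) → Set G.flags → RibbonGraph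
  | [], G, _ => G
  | GenOp.d :: w, G, A => applyWord w (G.pdual A) A
  | GenOp.t :: w, G, A => applyWord w (G.ppetrial A) A

/-- The twisted dual `G^{∏ᵢ ξᵢ(Aᵢ)}` determined by a partition
`A : Fin 6 → Set G.flags` of the edge set, where `ξ₀,…,ξ₅` are the six
elements `1, δ, τ, δτ, τδ, δτδ` of `⟨δ, τ | δ², τ², (δτ)³⟩`.
(The six operations act on disjoint sets of edges, so they commute.) -/
noncomputable def twistedDual (G : RibbonGraph) (A : Fin 6 → Set G.flags) : RibbonGraph :=
  applyWord [GenOp.d, GenOp.t, GenOp.d]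
    (applyWord [GenOp.t, GenOp.d]
      (applyWord [GenOp.d, GenOp.t]
        (applyWord [GenOp.t]
          (applyWord [GenOp.d]
            (applyWord [] G (A 0)) (A 1)) (A 2)) (A 3)) (A 4)) (A 5)

end RibbonGraph
namespace RibbonGraph

open Classical

variable {G : RibbonGraph} {A : Set G.flags}

/-- One step of `delSkip`: pass to the next flag around the vertex. -/
def vertexStep (G : RibbonGraph) (y : G.flags) : G.flags := G.t1 (G.t2 y)

theorem delSkip_eq_iterate {k : ℕ} : ∀ {n : ℕ} {y : G.flags},
    (∀ i < k, G.vertexStep^[i] y ∈ A) → G.vertexStep^[k] y ∉ A → k ≤ n →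
      G.delSkip A n y = G.vertexStep^[k] y := by
  induction k with
  | zero =>
    intro n y _ hk _
    cases n with
    | zero => rfl
    | succ n => exact if_neg hk
  | succ k ih =>
    intro n y hi hk hn
    cases n with
    | zero => omega
    | succ n =>
      have hy : y ∈ A := hi 0 (Nat.succ_pos k)
      rw [delSkip, if_pos hy]
      exact ih (fun i h => hi (i + 1) (by omega)) hk (by omega)

theorem vertexStep_reverse (h1 : Function.Involutive G.t1) (h2 : Function.Involutive G.t2)
    (i : ℕ) (y : G.flags) : G.vertexStep^[i] (G.t1 (G.vertexStep^[i] y)) = G.t1 y := by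
  induction i generalizing y with
  | zero => rfl
  | succ i ih =>
    rw [Function.iterate_succ_apply' (n := i) (x := G.t1 _), Function.iterate_succ_apply, ih]
    simp only [vertexStep, h1 _, h2 _]

theorem vertexStep_reverse_le (h1 : Function.Involutive G.t1) (h2 : Function.Involutive G.t2)
    {i k : ℕ} (hik : i ≤ k) (y : G.flags) :
    G.vertexStep^[i] (G.t1 (G.vertexStep^[k] y)) = G.t1 (G.vertexStep^[k - i] y) := by
  obtain ⟨j, rfl⟩ := Nat.exists_eq_add_of_le hik
  rw [Function.iterate_add_apply, vertexStep_reverse h1 h2, Nat.add_sub_cancel_left]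

theorem t1_vertexStep_succ (h1 : Function.Involutive G.t1) (j : ℕ) (y : G.flags) :
    G.t1 (G.vertexStep^[j + 1] y) = G.t2 (G.vertexStep^[j] y) := by
  rw [Function.iterate_succ_apply']
  exact h1 _

theorem exists_iterate_vertexStep_notMem [Finite G.flags] (h1 : Function.Involutive G.t1)
    (h2 : Function.Involutive G.t2) (hA : ∀ x ∈ A, G.t2 x ∈ A) {x : G.flags} (hx : x ∉ A) :
    ∃ k ≤ Nat.card G.flags, G.vertexStep^[k] (G.t1 x) ∉ A := by
  have hinj : Function.Injective G.vertexStep := h1.injective.comp h2.injective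
  obtain ⟨i, j, hij, he⟩ : ∃ i j : Fin (Nat.card G.flags + 1), i < j ∧
      G.vertexStep^[i] (G.t1 x) = G.vertexStep^[j] (G.t1 x) := by
    have hni : ¬ Function.Injective
        (fun i : Fin (Nat.card G.flags + 1) => G.vertexStep^[i] (G.t1 x)) := by
      intro hi
      have := Nat.card_le_card_of_injective _ hi
      simp at this
    simp only [Function.Injective, not_forall] at hni
    obtain ⟨i, j, he, hne⟩ := hni
    rcases lt_or_gt_of_ne hne with h | h
    · exact ⟨i, j, h, he⟩
    · exact ⟨j, i, h, he.symm⟩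
  have hlt : (i : ℕ) < j := hij
  obtain ⟨d, hd⟩ : ∃ d, (j : ℕ) = i + (d + 1) := ⟨j - i - 1, by omega⟩
  rw [hd, Function.iterate_add_apply] at he
  have hper := hinj.iterate i he
  refine ⟨d, by omega, fun hmem => hx ?_⟩
  have := hA _ hmem
  rwa [← t1_vertexStep_succ h1, ← hper, h1 x] at this

theorem del_t1_coe {x : (G.del A).flags}
    (hx : G.delSkip A (Nat.card G.flags + 1) (G.t1 x.1) ∉ A) :
    ((G.del A).t1 x).1 = G.delSkip A (Nat.card G.flags + 1) (G.t1 x.1) :=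
  congrArg Subtype.val (dif_pos hx)

theorem del_t1_eq [Finite G.flags] (h1 : Function.Involutive G.t1)
    (h2 : Function.Involutive G.t2) (hA : ∀ x ∈ A, G.t2 x ∈ A) (x : (G.del A).flags) :
    ∃ k ≤ Nat.card G.flags, (∀ i < k, G.vertexStep^[i] (G.t1 x.1) ∈ A) ∧
      ((G.del A).t1 x).1 = G.vertexStep^[k] (G.t1 x.1) := by
  have hex : ∃ k, G.vertexStep^[k] (G.t1 x.1) ∉ A :=
    (exists_iterate_vertexStep_notMem h1 h2 hA x.2).imp fun _ h => h.2
  obtain ⟨m, hm, hmA⟩ := exists_iterate_vertexStep_notMem h1 h2 hA x.2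
  have hk : Nat.find hex ≤ Nat.card G.flags := (Nat.find_min' hex hmA).trans hm
  have hlt : ∀ i < Nat.find hex, G.vertexStep^[i] (G.t1 x.1) ∈ A :=
    fun i hi => not_not.1 (Nat.find_min hex hi)
  have hs : G.delSkip A (Nat.card G.flags + 1) (G.t1 x.1) = _ :=
    delSkip_eq_iterate hlt (Nat.find_spec hex) (by omega)
  refine ⟨Nat.find hex, hk, hlt, ?_⟩
  have hd : G.delSkip A (Nat.card G.flags + 1) (G.t1 x.1) ∉ A := hs ▸ Nat.find_spec hex
  exact (del_t1_coe hd).trans hs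

theorem del_t1_involutive [Finite G.flags] (h1 : Function.Involutive G.t1)
    (h2 : Function.Involutive G.t2) (hA : ∀ x ∈ A, G.t2 x ∈ A) :
    Function.Involutive (G.del A).t1 := by
  intro x
  obtain ⟨k, hk, hlt, he⟩ := del_t1_eq h1 h2 hA x
  have hend : G.vertexStep^[k] (G.t1 ((G.del A).t1 x).1) = x.1 := by
    rw [he, vertexStep_reverse h1 h2, h1 x.1]
  have hs : G.delSkip A (Nat.card G.flags + 1) (G.t1 ((G.del A).t1 x).1) = x.1 := by
    rw [← hend]
    refine delSkip_eq_iterate (fun i hi => ?_) (hend ▸ x.2) (by omega)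
    obtain ⟨j, hj⟩ : ∃ j, k - i = j + 1 := ⟨k - i - 1, by omega⟩
    rw [he, vertexStep_reverse_le h1 h2 hi.le, hj, t1_vertexStep_succ h1]
    exact hA _ (hlt j (by omega))
  have hd : G.delSkip A (Nat.card G.flags + 1) (G.t1 ((G.del A).t1 x).1) ∉ A := hs ▸ x.2
  exact Subtype.ext ((del_t1_coe hd).trans hs)

theorem del_t1_ne [Finite G.flags] (h1 : Function.Involutive G.t1)
    (h2 : Function.Involutive G.t2) (hf1 : ∀ x, G.t1 x ≠ x) (hf2 : ∀ x, G.t2 x ≠ x)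
    (hA : ∀ x ∈ A, G.t2 x ∈ A) (x : (G.del A).flags) : (G.del A).t1 x ≠ x := by
  intro hx
  obtain ⟨k, -, -, he⟩ := del_t1_eq h1 h2 hA x
  rw [hx] at he
  have hrev : ∀ i ≤ k, G.vertexStep^[i] (G.t1 x.1) = G.t1 (G.vertexStep^[k - i] (G.t1 x.1)) := by
    intro i hi
    rw [← vertexStep_reverse_le h1 h2 hi, ← he]
  obtain ⟨m, rfl | rfl⟩ := Nat.even_or_odd' k
  · have := hrev m (by omega)
    rw [show 2 * m - m = m by omega] at this
    exact hf1 _ this.symm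
  · have := hrev m (by omega)
    rw [show 2 * m + 1 - m = m + 1 by omega, t1_vertexStep_succ h1] at this
    exact hf2 _ this.symm

theorem even_card_of_involutive {α : Type*} {f : α → α} (hf : Function.Involutive f)
    (hne : ∀ x, f x ≠ x) (s : Finset α) (hs : ∀ x ∈ s, f x ∈ s) : Even s.card := by
  rw [← ZMod.natCast_eq_zero_iff_even]
  have : ∑ _x ∈ s, (1 : ZMod 2) = 0 :=
    Finset.sum_involution (fun x _ => f x) (fun _ _ => by decide) (fun x _ _ => hne x)
      (fun x hx => hs x hx) (fun x _ => hf x)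
  simpa using this

theorem CheckerboardColourable.eulerian [Finite G.flags] (h1 : Function.Involutive G.t1)
    (h2 : Function.Involutive G.t2) (hf1 : ∀ x, G.t1 x ≠ x)
    (h : G.CheckerboardColourable) : G.Eulerian := by
  obtain ⟨c, hc⟩ := h
  intro x
  have := Fintype.ofFinite G.flags
  let s : Finset G.flags := {y | G.sameVertex x y}
  have hs1 : ∀ y ∈ s, G.t1 y ∈ s := fun y hy => by
    simp only [s, Finset.mem_filter, Finset.mem_univ, true_and] at hy ⊢
    exact hy.tail (Or.inl rfl)
  have hs2 : ∀ y ∈ s, G.t2 y ∈ s := fun y hy => by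
    simp only [s, Finset.mem_filter, Finset.mem_univ, true_and] at hy ⊢
    exact hy.tail (Or.inr rfl)
  have hdeg : G.degree x = s.card / 2 := by
    rw [degree, ← Set.ncard_coe_finset s]
    simp [s]
  have hcard : (s.filter fun y => c y = true).card = (s.filter fun y => ¬ c y = true).card := by
    refine Finset.card_bij (fun y _ => G.t2 y) ?_ (fun _ _ _ _ e => h2.injective e) ?_
    · intro y hy
      rw [Finset.mem_filter] at hy ⊢
      exact ⟨hs2 y hy.1, by simp [(hc y).2.2, hy.2]⟩
    · intro y hy
      rw [Finset.mem_filter] at hy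
      exact ⟨G.t2 y, Finset.mem_filter.2 ⟨hs2 y hy.1, by simpa [(hc y).2.2] using hy.2⟩, h2 y⟩
  have heven : Even (s.filter fun y => c y = true).card :=
    even_card_of_involutive h1 hf1 _ fun y hy => by
      rw [Finset.mem_filter] at hy ⊢
      exact ⟨hs1 y hy.1, (hc y).2.1.trans hy.2⟩
  have htot := s.card_filter_add_card_filter_not (fun y => c y = true)
  rw [hdeg, show s.card / 2 = (s.filter fun y => c y = true).card by omega]
  exact heven

theorem delSkip_colour {c : G.flags → Bool} (hc1 : ∀ x, c (G.t1 x) = c x)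
    (hc2 : ∀ x ∈ A, c (G.t2 x) = c x) (n : ℕ) (y : G.flags) :
    c (G.delSkip A n y) = c y := by
  induction n generalizing y with
  | zero => rfl
  | succ n ih =>
    rw [delSkip]
    split_ifs with hy
    · rw [ih, hc1, hc2 y hy]
    · rfl

theorem del_checkerboardColourable (h0 : Function.Involutive G.t0)
    (h2 : Function.Involutive G.t2) (hA : G.IsEdgeSet A)
    (h : (G.pdual A).CheckerboardColourable) : (G.del A).CheckerboardColourable := by
  obtain ⟨c, hc⟩ := h
  have hc1 : ∀ x, c (G.t1 x) = c x := fun x => (hc x).2.1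
  have hc2 : ∀ x ∈ A, c (G.t2 x) = c x := fun x hx => by
    simpa [pdual, hx] using (hc x).1
  refine ⟨fun x => c x.1, fun x => ⟨?_, ?_, ?_⟩⟩
  · have hx : G.t0 x.1 ∉ A := fun hx => x.2 (h0 x.1 ▸ (hA _ hx).1)
    simpa [pdual, x.2, del, hx] using (hc x.1).1
  · by_cases hx : G.delSkip A (Nat.card G.flags + 1) (G.t1 x.1) ∉ A
    · exact (congrArg (c : G.flags → Bool) (del_t1_coe (G := G) (A := A) hx)).trans
        ((delSkip_colour (G := G) hc1 hc2 _ _).trans (hc1 _))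
    · exact congrArg (fun y => c y.1) (dif_neg hx : (G.del A).t1 x = x)
  · have hx : G.t2 x.1 ∉ A := fun hx => x.2 (h2 x.1 ▸ (hA _ hx).2)
    simpa [pdual, x.2, del, hx] using (hc x.1).2.2

theorem del_checkerboardColourable_and_eulerian [Finite G.flags] (h0 : Function.Involutive G.t0)
    (h1 : Function.Involutive G.t1) (h2 : Function.Involutive G.t2)
    (hf1 : ∀ x, G.t1 x ≠ x) (hf2 : ∀ x, G.t2 x ≠ x) (hA : G.IsEdgeSet A)
    (h : (G.pdual A).CheckerboardColourable) :
    (G.del A).CheckerboardColourable ∧ (G.del A).Eulerian := by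
  have hA2 : ∀ x ∈ A, G.t2 x ∈ A := fun x hx => (hA x hx).2
  have hdel := del_checkerboardColourable h0 h2 hA h
  have : Finite (G.del A).flags := inferInstanceAs (Finite {x : G.flags // x ∉ A})
  refine ⟨hdel, hdel.eulerian (del_t1_involutive h1 h2 hA2) ?_ (del_t1_ne h1 h2 hf1 hf2 hA2)⟩
  intro x
  have hx : G.t2 x.1 ∉ A := fun hx => x.2 (h2 x.1 ▸ (hA _ hx).2)
  apply Subtype.ext
  simp [del, hx, h2 x.1, x.2]

theorem gdual_t0 : G.gdual.t0 = G.t2 := by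
  funext x
  exact if_pos (Set.mem_univ x)

theorem gdual_t2 : G.gdual.t2 = G.t0 := by
  funext x
  exact if_pos (Set.mem_univ x)

theorem gdual_pdual_compl : G.gdual.pdual (Aᶜ : Set G.flags) = G.pdual A := by
  have hite (f g : G.flags → G.flags) :
      (fun x => @ite _ (x ∈ (Aᶜ : Set G.flags)) (propDecidable _) (f x) (g x)) =
        fun x => if x ∈ A then g x else f x := by
    funext x
    by_cases hx : x ∈ A <;> simp [hx]
  simp only [pdual, gdual_t0, gdual_t2]
  exact congrArg₂ (fun a b => RibbonGraph.mk G.flags a G.t1 b) (hite _ _) (hite _ _)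

end RibbonGraph

open RibbonGraph in
/-- **Theorem 4 (Statement 3).** If the partial dual `G^A` is checkerboard
colourable, then `G − A` and `G* − Aᶜ` are both checkerboard colourable,
and hence both Eulerian. -/
theorem del_checkerboard_of_pdual_checkerboard (G : RibbonGraph)
    (hG : G.IsRibbon) (A : Set G.flags) (hA : G.IsEdgeSet A)
    (h : (G.pdual A).CheckerboardColourable) :
    (G.del A).CheckerboardColourable ∧ (G.gdual.del Aᶜ).CheckerboardColourable ∧
      (G.del A).Eulerian ∧ (G.gdual.del Aᶜ).Eulerian := by
  obtain ⟨hfin, h0, h1, h2, -, hf0, hf1, hf2, -⟩ := hG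
  have hdel := del_checkerboardColourable_and_eulerian h0 h1 h2 hf1 hf2 hA h
  have hAc : G.gdual.IsEdgeSet (Aᶜ : Set G.flags) := by
    intro x hx
    rw [gdual_t0, gdual_t2]
    exact ⟨fun hm => hx (h2 x ▸ (hA _ hm).2), fun hm => hx (h0 x ▸ (hA _ hm).1)⟩
  have : Finite G.gdual.flags := hfin
  have hdual := del_checkerboardColourable_and_eulerian (G := G.gdual) (A := (Aᶜ : Set G.flags))
    (gdual_t0 (G := G) ▸ h2) h1 (gdual_t2 (G := G) ▸ h0) hf1 (gdual_t2 (G := G) ▸ hf0) hAc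
    (gdual_pdual_compl (G := G) ▸ h)
  exact ⟨hdel.1, hdual.1, hdel.2, hdual.2⟩
end

section
/- The converse of the bipartite partial-dual lemma fails: there exist an embedded graph G and a subset A ⊆ E(G) such that (G − A^c)* and (G* − A)* are both bipartite but the partial dual G^A is not bipartite, where A^c = E(G) \ A. -/
namespace RibbonGraph

theorem delSkip_invariant {α : Type*} (G : RibbonGraph) (A : Set G.flags) (c : G.flags → α)
    (h1 : ∀ x, c (G.t1 x) = c x) (h2 : ∀ x ∈ A, c (G.t2 x) = c x) (n : ℕ) (y : G.flags) :
    c (G.delSkip A n y) = c y := by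
  induction n generalizing y with
  | zero => rfl
  | succ n ih =>
    unfold delSkip
    split_ifs with hy
    · rw [ih, h1, h2 y hy]
    · rfl

/-- A colouring of all flags of `G` that is constant around the vertices along deleted edges and
checkerboard along surviving ones restricts to a proper colouring of `(G - A)*`. -/
theorem bipartite_gdual_del (G : RibbonGraph) (A : Set G.flags) (c : G.flags → Bool)
    (h1 : ∀ x, c (G.t1 x) = c x) (h2 : ∀ x ∈ A, c (G.t2 x) = c x)
    (h : ∀ x ∉ A, c (G.t0 x) = c x ∧ c (G.t2 x) = !c x ∧ G.t2 x ∉ A) :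
    ((G.del A).gdual).Bipartite := by
  refine ⟨fun x : {x : G.flags // x ∉ A} => c x.1, ?_⟩
  rintro ⟨x, hx⟩
  obtain ⟨hc0, hc2, hA2⟩ := h x hx
  refine ⟨?_, ?_, ?_⟩
  · simp [gdual, pdual, del, hA2, hc2]
  · simp only [gdual, pdual, del]
    split_ifs
    · rfl
    · exact (delSkip_invariant G A c h1 h2 _ _).trans (h1 x)
  · simp only [gdual, pdual, del, Set.mem_univ, if_true]
    split_ifs
    · rfl
    · exact hc0

/-- A ribbon graph with three edges, whose flags are `{0,…,3}`, `{4,…,7}` and `{8,…,11}`. -/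
def threeEdgeGraph : RibbonGraph where
  flags := Fin 12
  t0 := ![1, 0, 3, 2, 5, 4, 7, 6, 9, 8, 11, 10]
  t1 := ![4, 5, 8, 10, 0, 1, 9, 11, 2, 6, 3, 7]
  t2 := ![2, 3, 0, 1, 6, 7, 4, 5, 10, 11, 8, 9]

/-- The first two edges of `threeEdgeGraph`. -/
def firstTwoEdges : Set threeEdgeGraph.flags := {x : Fin 12 | x < 8}

theorem threeEdgeGraph_isRibbon : threeEdgeGraph.IsRibbon := by
  refine ⟨inferInstanceAs (Finite (Fin 12)), ?_⟩
  simp only [threeEdgeGraph, Function.Involutive]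
  decide

theorem firstTwoEdges_isEdgeSet : threeEdgeGraph.IsEdgeSet firstTwoEdges := by
  change ∀ x : Fin 12, x < 8 → (show Fin 12 from threeEdgeGraph.t0 x) < 8 ∧
    (show Fin 12 from threeEdgeGraph.t2 x) < 8
  decide

theorem bipartite_gdual_del_compl_firstTwoEdges :
    ((threeEdgeGraph.del firstTwoEdgesᶜ).gdual).Bipartite := by
  let c : Fin 12 → Bool := ![false, false, true, true, false, false, true, true,
    true, true, true, true]
  apply bipartite_gdual_del threeEdgeGraph firstTwoEdgesᶜ c
  · change ∀ x : Fin 12, c (threeEdgeGraph.t1 x) = c x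
    decide
  · change ∀ x : Fin 12, ¬ x < 8 → c (threeEdgeGraph.t2 x) = c x
    decide
  · change ∀ x : Fin 12, ¬ ¬ x < 8 → c (threeEdgeGraph.t0 x) = c x ∧
      c (threeEdgeGraph.t2 x) = !c x ∧ ¬ ¬ (show Fin 12 from threeEdgeGraph.t2 x) < 8
    decide

theorem bipartite_gdual_del_firstTwoEdges :
    ((threeEdgeGraph.gdual.del firstTwoEdges).gdual).Bipartite := by
  let c : Fin 12 → Bool := ![false, false, false, false, false, false, true, true,
    false, true, false, true]
  apply bipartite_gdual_del threeEdgeGraph.gdual firstTwoEdges c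
  · change ∀ x : Fin 12, c (threeEdgeGraph.t1 x) = c x
    decide
  · simp only [gdual, pdual, Set.mem_univ, if_true]
    change ∀ x : Fin 12, x < 8 → c (threeEdgeGraph.t0 x) = c x
    decide
  · simp only [gdual, pdual, Set.mem_univ, if_true]
    change ∀ x : Fin 12, ¬ x < 8 → c (threeEdgeGraph.t2 x) = c x ∧
      c (threeEdgeGraph.t0 x) = !c x ∧ ¬ (show Fin 12 from threeEdgeGraph.t0 x) < 8
    decide

theorem not_bipartite_pdual_firstTwoEdges :
    ¬ (threeEdgeGraph.pdual firstTwoEdges).Bipartite := by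
  rintro ⟨c, h⟩
  change Fin 12 → Bool at c
  have hA : ∀ x : Fin 12, x < 8 → c (threeEdgeGraph.t2 x) = !c x := by
    intro x (hx : x ∈ firstTwoEdges)
    exact (congrArg c (if_pos hx)).symm.trans (h x).1
  have hB : ∀ x : Fin 12, ¬ x < 8 → c (threeEdgeGraph.t0 x) = !c x := by
    intro x (hx : x ∉ firstTwoEdges)
    exact (congrArg c (if_neg hx)).symm.trans (h x).1
  have h1 : ∀ x : Fin 12, c (threeEdgeGraph.t1 x) = c x := fun x => (h x).2.1
  have h20 : c 2 = !c 0 := hA 0 (by decide)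
  have h40 : c 4 = c 0 := h1 0
  have h64 : c 6 = !c 4 := hA 4 (by decide)
  have h96 : c 9 = c 6 := h1 6
  have h98 : c 9 = !c 8 := hB 8 (by decide)
  have h82 : c 8 = c 2 := h1 2
  simp_all

end RibbonGraph

open RibbonGraph in
/-- The converse of the bipartite partial-dual lemma fails:
there are an embedded graph `G` and `A ⊆ E(G)` with `(G − Aᶜ)*` and
`(G* − A)*` both bipartite, while the partial dual `G^A` is not bipartite. -/
theorem converse_bipartite_lemma_fails :
    ∃ (G : RibbonGraph) (A : Set G.flags), G.IsRibbon ∧ G.IsEdgeSet A ∧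
      ((G.del Aᶜ).gdual).Bipartite ∧ ((G.gdual.del A).gdual).Bipartite ∧
      ¬ (G.pdual A).Bipartite := by
  exact ⟨threeEdgeGraph, firstTwoEdges, threeEdgeGraph_isRibbon, firstTwoEdges_isEdgeSet,
    bipartite_gdual_del_compl_firstTwoEdges, bipartite_gdual_del_firstTwoEdges,
    not_bipartite_pdual_firstTwoEdges⟩
end

section
/- The medial graph of every orientable embedded graph admits an all-crossing direction, obtained by directing the edges along the straight-ahead walks of the medial graph. -/
/-- A fixed-point-free involution admits a two-colouring exchanging each point with its image. -/
theorem Function.Involutive.exists_bool_flip {α : Type*} {f : α → α}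
    (hf : Function.Involutive f) (hfix : ∀ x, f x ≠ x) :
    ∃ o : α → Bool, ∀ x, o (f x) = !o x := by
  classical
  let : LinearOrder α := linearOrderOfSTO WellOrderingRel
  refine ⟨fun x => decide (x < f x), fun x => ?_⟩
  rcases lt_or_gt_of_ne (hfix x) with h | h
  · simp [hf x, h, h.not_gt]
  · simp [hf x, h, h.not_gt]

/-- If `a` and `b` are fixed-point-free involutions, then `a` moves every point to another cycle
of `a * b`. -/
theorem Equiv.Perm.not_sameCycle_mul_of_involutive {α : Type*} {a b : Equiv.Perm α}
    (ha : Function.Involutive a) (hb : Function.Involutive b)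
    (hafix : ∀ x, a x ≠ x) (hbfix : ∀ x, b x ≠ x) (x : α) : ¬ (a * b).SameCycle x (a x) := by
  have hsemi : SemiconjBy a (a * b) (a * b)⁻¹ := by
    rw [SemiconjBy, eq_inv_mul_iff_mul_eq]
    ext y
    simp [ha _, hb _]
  have hconj (n : ℤ) (y : α) : a (((a * b) ^ n) y) = ((a * b) ^ (-n)) (a y) := by
    have h := Equiv.congr_fun (hsemi.zpow_right n).eq y
    rwa [inv_zpow, ← zpow_neg] at h
  rintro ⟨n, hn⟩
  obtain ⟨m, rfl | rfl⟩ := Int.even_or_odd' n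
  · apply hafix (((a * b) ^ m) x)
    rw [hconj, ← hn, ← Equiv.Perm.mul_apply, ← zpow_add]
    congr 2
    ring
  · apply hbfix (((a * b) ^ m) x)
    apply a.injective
    rw [hconj, ← hn, ← Equiv.Perm.mul_apply, ← Equiv.Perm.mul_apply, ← Equiv.Perm.mul_apply,
      ← zpow_add, ← zpow_one_add]
    congr 2
    ring

/-- Any two fixed-point-free involutions of a type admit a common two-colouring whose colours
both of them exchange. -/
theorem Function.Involutive.exists_bool_flip_pair {α : Type*} {f g : α → α}
    (hf : Function.Involutive f) (hg : Function.Involutive g)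
    (hffix : ∀ x, f x ≠ x) (hgfix : ∀ x, g x ≠ x) :
    ∃ o : α → Bool, (∀ x, o (f x) = !o x) ∧ ∀ x, o (g x) = !o x := by
  set a := hf.toPerm f
  set b := hg.toPerm g
  let s := Equiv.Perm.SameCycle.setoid (a * b)
  have hmap {x y : α} (h : (a * b).SameCycle x y) : (a * b).SameCycle (a x) (a y) := by
    have hconj : a * (a * b) * a⁻¹ = (a * b)⁻¹ := by
      rw [eq_inv_iff_mul_eq_one]
      ext z
      simp [a, b, hf _, hg _]
    have hk : (a * (a * b) * a⁻¹).SameCycle (a x) (a y) := by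
      simpa [Equiv.Perm.sameCycle_conj] using h
    rwa [hconj, Equiv.Perm.sameCycle_inv] at hk
  let F : Quotient s → Quotient s := Quotient.map a fun _ _ h => hmap h
  have hF : Function.Involutive F := by
    rintro ⟨x⟩
    exact congrArg (Quotient.mk s) (hf x)
  have hFfix (q : Quotient s) : F q ≠ q := by
    induction q using Quotient.inductionOn with
    | h x =>
      intro h
      exact Equiv.Perm.not_sameCycle_mul_of_involutive hf hg hffix hgfix x (Quotient.exact h.symm)
  obtain ⟨o, ho⟩ := hF.exists_bool_flip hFfix
  refine ⟨fun x => o (Quotient.mk s x), fun x => ho (Quotient.mk s x), fun x => ?_⟩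
  have h : F (Quotient.mk s (g x)) = Quotient.mk s x :=
    Quotient.sound (show (a * b).SameCycle (a (g x)) x from ⟨-1, by simp [a, b, hf _, hg _]⟩)
  have hk := ho (Quotient.mk s (g x))
  rw [h] at hk
  simp [hk]

open RibbonGraph in
/-- The medial graph of every orientable embedded graph
admits an all-crossing direction. -/
theorem exists_all_crossing_direction (G : RibbonGraph) (hG : G.IsRibbon)
    (hor : G.Orientable) :
    ∃ o : G.flags → Bool, G.IsAllCrossing o := by
  obtain ⟨-, h0, h1, h2, hcomm, -, hfix1, -, hfix⟩ := hG
  refine h1.exists_bool_flip_pair (g := fun x => G.t0 (G.t2 x)) (fun x => ?_) hfix1 hfix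
  simp only [hcomm x, h2 _, h0 _]
end
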